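/- arXiv:0807.4336 — 3 statements merged into one kernel-verified Lean document; each statement's English description precedes it below -/
import Mathlib

section
/- For all q, r > 0 with q ≠ r and all x, z ∈ ℝ, the function y ↦ u_q(x − y) u_r(y − z) is Lebesgue integrable on ℝ and ∫_ℝ u_q(x − y) u_r(y − z) dy = (u_r(x − z) − u_q(x − z))/(q − r) (the resolvent equation in integral form). In particular, taking x = z = 0 and using u_q(−y) = u_q(y): ∫_ℝ u_q(y) u_r(y) dy = (u_r(0) − u_q(0))/(q − r). -/
open MeasureTheory Set Filter Real
/-- The q-resolvent density `u_q(x) = (1/π) ∫_0^∞ cos(xλ)/(q + λ^α) dλ`. -/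
noncomputable def resolventDensity (α q x : ℝ) : ℝ :=
  (1 / π) * ∫ l in Ioi (0 : ℝ), Real.cos (x * l) / (q + l ^ α)

open scoped FourierTransform ComplexInnerProductSpace

section FourierL2

variable {V : Type*} [NormedAddCommGroup V] [InnerProductSpace ℝ V] [FiniteDimensional ℝ V]
  [MeasurableSpace V] [BorelSpace V]

/-- On `L¹ ∩ L²` the `L²` Fourier transform is given by the Fourier integral. -/
theorem coeFn_fourier_toLp_two {f : V → ℂ} (hf : Integrable f) (hf2 : MemLp f 2) :
    (𝓕 (hf2.toLp f) : Lp (α := V) ℂ 2 volume) =ᵐ[volume] 𝓕 f := by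
  have hcont : Continuous (𝓕 f) :=
    VectorFourier.fourierIntegral_continuous Real.continuous_fourierChar
      (by exact continuous_inner) hf
  refine ae_eq_of_integral_contDiff_smul_eq ((Lp.memLp _).locallyIntegrable one_le_two)
    hcont.locallyIntegrable fun g hg hgc => ?_
  have hgc' : HasCompactSupport (fun x => (g x : ℂ)) := hgc.comp_left Complex.ofReal_zero
  let φ : SchwartzMap V ℂ := hgc'.toSchwartzMap (Complex.ofRealCLM.contDiff.comp hg)
  have hφ (x : V) : φ x = (g x : ℂ) := rfl
  have h : ∫ x, (𝓕 φ) x • (hf2.toLp f) x =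
      ∫ x, φ x • (𝓕 (hf2.toLp f) : Lp (α := V) ℂ 2 volume) x := by
    have := congrArg (fun T : TemperedDistribution V ℂ => T φ)
      (Lp.fourier_toTemperedDistribution_eq (hf2.toLp f))
    simpa only [TemperedDistribution.fourier_apply, Lp.toTemperedDistribution_apply] using this
  have hflip : ∫ x, 𝓕 f x • φ x = ∫ x, f x • 𝓕 (φ : V → ℂ) x := by
    have := VectorFourier.integral_fourierIntegral_smul_eq_flip (L := innerₗ V) (μ := volume)
      (ν := volume) Real.continuous_fourierChar continuous_inner hf φ.integrable
    rwa [flip_innerₗ] at this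
  have hLp : ∫ x, (𝓕 φ) x • (hf2.toLp f) x = ∫ x, f x • 𝓕 (φ : V → ℂ) x := by
    refine integral_congr_ae (hf2.coeFn_toLp.mono fun x hx => ?_)
    simp only [hx, SchwartzMap.fourier_coe, smul_eq_mul, mul_comm]
  have key := (h.symm.trans hLp).trans hflip.symm
  simpa only [hφ, smul_eq_mul, mul_comm, Complex.real_smul] using key

theorem integrable_inner_fourier {f g : V → ℂ} (hf : Integrable f) (hf2 : MemLp f 2)
    (hg : Integrable g) (hg2 : MemLp g 2) :
    Integrable (fun y => ⟪𝓕 f y, 𝓕 g y⟫) := by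
  refine (L2.integrable_inner (𝕜 := ℂ) (𝓕 (hf2.toLp f) : Lp (α := V) ℂ 2 volume)
    (𝓕 (hg2.toLp g) : Lp (α := V) ℂ 2 volume)).congr ?_
  filter_upwards [coeFn_fourier_toLp_two hf hf2, coeFn_fourier_toLp_two hg hg2] with y h₁ h₂
  rw [h₁, h₂]

/-- Parseval's identity on `L¹ ∩ L²`. -/
theorem integral_inner_fourier {f g : V → ℂ} (hf : Integrable f) (hf2 : MemLp f 2)
    (hg : Integrable g) (hg2 : MemLp g 2) :
    ∫ y, ⟪𝓕 f y, 𝓕 g y⟫ = ∫ x, ⟪f x, g x⟫ := by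
  have h := Lp.inner_fourier_eq (hf2.toLp f) (hg2.toLp g)
  simp only [L2.inner_def] at h
  calc ∫ y, ⟪𝓕 f y, 𝓕 g y⟫
      = ∫ y, ⟪(𝓕 (hf2.toLp f) : Lp (α := V) ℂ 2 volume) y,
          (𝓕 (hg2.toLp g) : Lp (α := V) ℂ 2 volume) y⟫ := by
        refine integral_congr_ae ?_
        filter_upwards [coeFn_fourier_toLp_two hf hf2, coeFn_fourier_toLp_two hg hg2] with y h₁ h₂
        rw [h₁, h₂]
    _ = ∫ x, ⟪(hf2.toLp f) x, (hg2.toLp g) x⟫ := h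
    _ = ∫ x, ⟪f x, g x⟫ := by
        refine integral_congr_ae ?_
        filter_upwards [hf2.coeFn_toLp, hg2.coeFn_toLp] with x h₁ h₂
        rw [h₁, h₂]

end FourierL2

theorem Real.fourier_exp_mul (f : ℝ → ℂ) (x y : ℝ) :
    𝓕 (fun v : ℝ => Complex.exp (↑(2 * π * v * x) * Complex.I) * f v) y = 𝓕 f (y - x) := by
  simp only [Real.fourier_real_eq_integral_exp_smul, smul_eq_mul, ← mul_assoc, ← Complex.exp_add]
  congr! 4 with v
  push_cast
  ring

theorem Real.fourier_ofReal_of_even {f : ℝ → ℝ} (hf : Integrable f) (heven : ∀ v, f (-v) = f v)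
    (w : ℝ) :
    𝓕 (fun v => (f v : ℂ)) w = ((2 * ∫ v in Ioi 0, cos (2 * π * v * w) * f v : ℝ) : ℂ) := by
  rw [Real.fourier_real_eq_integral_exp_smul]
  have hint : Integrable fun v : ℝ =>
      Complex.exp (↑(-2 * π * v * w) * Complex.I) • (f v : ℂ) := by
    refine hf.ofReal.bdd_mul (c := 1) (by fun_prop) (ae_of_all _ fun v => ?_)
    rw [Complex.norm_exp_ofReal_mul_I]
  have hsum (v : ℝ) : Complex.exp (↑(-2 * π * v * w) * Complex.I) • (f v : ℂ) +
      Complex.exp (↑(-2 * π * -v * w) * Complex.I) • (f (-v) : ℂ) =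
      2 * ((cos (2 * π * v * w) * f v : ℝ) : ℂ) := by
    have h₁ : -2 * π * v * w = -(2 * π * v * w) := by ring
    have h₂ : -2 * π * -v * w = 2 * π * v * w := by ring
    rw [heven, h₁, h₂]
    push_cast
    rw [Complex.cos]
    simp only [smul_eq_mul]
    ring
  have hneg := integral_neg_eq_self (fun v : ℝ =>
    Complex.exp (↑(-2 * π * v * w) * Complex.I) • (f v : ℂ)) volume
  have hadd := integral_add hint hint.comp_neg
  simp only [hsum] at hadd
  rw [hneg, integral_const_mul, integral_complex_ofReal, ← two_mul] at hadd
  rw [← mul_left_cancel₀ two_ne_zero hadd, ← integral_comp_abs]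
  congr! 3 with v
  rcases abs_choice v with h | h
  · rw [h]
  · rw [h, heven, mul_neg, neg_mul, cos_neg]

theorem Real.one_add_rpow_le_mul {q α t : ℝ} (hq : 0 < q) (hα : 0 ≤ α) (ht : 0 ≤ t) :
    (1 + t) ^ α ≤ 2 ^ α * (1 + q⁻¹) * (q + t ^ α) := by
  have h0 : 0 ≤ t ^ α := rpow_nonneg ht α
  have hmax : (max 1 t) ^ α ≤ 1 + t ^ α := by
    rcases max_choice 1 t with h | h <;> rw [h]
    · simpa using h0
    · linarith
  calc (1 + t) ^ α ≤ (2 * max 1 t) ^ α :=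
        rpow_le_rpow (by linarith) (by linarith [le_max_left 1 t, le_max_right 1 t]) hα
    _ = 2 ^ α * (max 1 t) ^ α := mul_rpow zero_le_two (by positivity)
    _ ≤ 2 ^ α * (1 + t ^ α) := by gcongr
    _ ≤ 2 ^ α * ((1 + q⁻¹) * (q + t ^ α)) := by
        gcongr
        have : (1 + q⁻¹) * (q + t ^ α) = 1 + t ^ α + (q + q⁻¹ * t ^ α) := by
          field_simp
          ring
        have : 0 ≤ q⁻¹ * t ^ α := by positivity
        linarith
    _ = _ := by ring

/-- The Fourier multiplier of the `q`-resolvent of the symmetric `α`-stable process. -/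
noncomputable def resolventSymbol (α q v : ℝ) : ℝ := (q + |2 * π * v| ^ α)⁻¹

section Symbol

variable {α q : ℝ}

theorem resolventSymbol_nonneg (hq : 0 < q) (v : ℝ) : 0 ≤ resolventSymbol α q v := by
  unfold resolventSymbol; positivity

theorem resolventSymbol_le (hq : 0 < q) (v : ℝ) : resolventSymbol α q v ≤ q⁻¹ := by
  unfold resolventSymbol
  gcongr
  linarith [rpow_nonneg (abs_nonneg (2 * π * v)) α]

theorem resolventSymbol_neg (v : ℝ) : resolventSymbol α q (-v) = resolventSymbol α q v := by
  simp [resolventSymbol]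

theorem measurable_resolventSymbol : Measurable (resolventSymbol α q) := by
  unfold resolventSymbol; fun_prop

theorem integrable_resolventSymbol (hα : 1 < α) (hq : 0 < q) :
    Integrable (resolventSymbol α q) := by
  have h : Integrable fun l : ℝ => 2 ^ α * (1 + q⁻¹) * (1 + ‖l‖) ^ (-α) :=
    (integrable_one_add_norm (by simpa using hα)).const_mul _
  refine (h.comp_mul_left' (R := 2 * π) (by positivity)).mono'
    measurable_resolventSymbol.aestronglyMeasurable (ae_of_all _ fun v => ?_)
  rw [norm_of_nonneg (resolventSymbol_nonneg hq v), resolventSymbol,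
    rpow_neg (by positivity), ← div_eq_mul_inv, norm_eq_abs]
  have := one_add_rpow_le_mul hq (zero_le_one.trans hα.le) (abs_nonneg (2 * π * v))
  rw [inv_le_comm₀ (by positivity) (by positivity), inv_div, div_le_iff₀ (by positivity)]
  linarith

theorem fourier_resolventSymbol (hα : 1 < α) (hq : 0 < q) (w : ℝ) :
    𝓕 (fun v => (resolventSymbol α q v : ℂ)) w = (resolventDensity α q w : ℂ) := by
  rw [fourier_ofReal_of_even (integrable_resolventSymbol hα hq) resolventSymbol_neg]
  have h := integral_comp_mul_left_Ioi (fun l => cos (w * l) / (q + l ^ α)) 0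
    (b := 2 * π) (by positivity)
  rw [mul_zero, smul_eq_mul] at h
  have hcongr : ∫ v in Ioi 0, cos (2 * π * v * w) * resolventSymbol α q v =
      ∫ v in Ioi 0, cos (w * (2 * π * v)) / (q + (2 * π * v) ^ α) := by
    refine setIntegral_congr_fun measurableSet_Ioi fun v (hv : 0 < v) => ?_
    rw [resolventSymbol, abs_of_nonneg (by positivity), div_eq_mul_inv, mul_comm w]
  rw [hcongr, h, resolventDensity]
  congr 1
  field_simp

theorem resolventDensity_neg (x : ℝ) : resolventDensity α q (-x) = resolventDensity α q x := by
  simp [resolventDensity]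

/-- The modulated multiplier, with Fourier transform `y ↦ u_q(y - x)`. -/
noncomputable def modulatedSymbol (α q x v : ℝ) : ℂ :=
  Complex.exp (↑(2 * π * v * x) * Complex.I) * resolventSymbol α q v

theorem fourier_modulatedSymbol (hα : 1 < α) (hq : 0 < q) (x y : ℝ) :
    𝓕 (modulatedSymbol α q x) y = (resolventDensity α q (y - x) : ℂ) :=
  (fourier_exp_mul _ x y).trans (fourier_resolventSymbol hα hq _)

theorem norm_modulatedSymbol (hq : 0 < q) (x v : ℝ) :
    ‖modulatedSymbol α q x v‖ = resolventSymbol α q v := by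
  rw [modulatedSymbol, norm_mul, Complex.norm_exp_ofReal_mul_I, one_mul, Complex.norm_real,
    norm_of_nonneg (resolventSymbol_nonneg hq v)]

theorem integrable_modulatedSymbol (hα : 1 < α) (hq : 0 < q) (x : ℝ) :
    Integrable (modulatedSymbol α q x) := by
  refine (integrable_resolventSymbol hα hq).mono' ?_
    (ae_of_all _ fun v => (norm_modulatedSymbol hq x v).le)
  have := measurable_resolventSymbol (α := α) (q := q)
  unfold modulatedSymbol
  fun_prop

theorem memLp_two_modulatedSymbol (hα : 1 < α) (hq : 0 < q) (x : ℝ) :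
    MemLp (modulatedSymbol α q x) 2 := by
  have hint := integrable_modulatedSymbol hα hq x
  refine (memLp_two_iff_integrable_sq_norm hint.aestronglyMeasurable).2 ?_
  simp only [sq]
  refine hint.norm.bdd_mul (c := q⁻¹) hint.norm.aestronglyMeasurable (ae_of_all _ fun v => ?_)
  rw [norm_norm, norm_modulatedSymbol hq]
  exact resolventSymbol_le hq v

theorem inner_modulatedSymbol {r : ℝ} (hq : 0 < q) (hr : 0 < r) (hqr : q ≠ r) (x z v : ℝ) :
    ⟪modulatedSymbol α q x v, modulatedSymbol α r z v⟫ =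
      (modulatedSymbol α r (z - x) v - modulatedSymbol α q (z - x) v) / (q - r) := by
  have hne : (q : ℂ) - r ≠ 0 := by exact_mod_cast sub_ne_zero.2 hqr
  have hres : (resolventSymbol α q v : ℂ) * resolventSymbol α r v * (q - r) =
      resolventSymbol α r v - resolventSymbol α q v := by
    norm_cast
    have : 0 ≤ |2 * π * v| ^ α := by positivity
    unfold resolventSymbol
    field_simp
    ring
  have hexp : Complex.exp (↑(2 * π * v * (z - x)) * Complex.I) =
      Complex.exp (↑(2 * π * v * z) * Complex.I) *
        Complex.exp (-(↑(2 * π * v * x) * Complex.I)) := by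
    rw [← Complex.exp_add]
    push_cast
    ring_nf
  rw [eq_div_iff hne, RCLike.inner_apply]
  simp only [modulatedSymbol, map_mul, Complex.conj_ofReal, ← Complex.exp_conj, Complex.conj_I,
    hexp, ← mul_sub, ← hres, mul_neg]
  ring

end Symbol

/-- Resolvent equation in integral form: for `q, r > 0` with `q ≠ r` and `x, z ∈ ℝ`,
the function `y ↦ u_q(x − y) u_r(y − z)` is Lebesgue integrable on `ℝ` and
`∫ u_q(x − y) u_r(y − z) dy = (u_r(x − z) − u_q(x − z))/(q − r)`.
In particular `∫ u_q(y) u_r(y) dy = (u_r(0) − u_q(0))/(q − r)`. -/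
theorem resolvent_equation (α : ℝ) (hα1 : 1 < α) (hα2 : α ≤ 2)
    (q r : ℝ) (hq : 0 < q) (hr : 0 < r) (hqr : q ≠ r) :
    (∀ x z : ℝ,
      Integrable (fun y : ℝ => resolventDensity α q (x - y) * resolventDensity α r (y - z)) ∧
      ∫ y : ℝ, resolventDensity α q (x - y) * resolventDensity α r (y - z)
        = (resolventDensity α r (x - z) - resolventDensity α q (x - z)) / (q - r)) ∧
    ∫ y : ℝ, resolventDensity α q y * resolventDensity α r y
      = (resolventDensity α r 0 - resolventDensity α q 0) / (q - r) := by
  have key (x z : ℝ) :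
      Integrable (fun y : ℝ => resolventDensity α q (x - y) * resolventDensity α r (y - z)) ∧
      ∫ y : ℝ, resolventDensity α q (x - y) * resolventDensity α r (y - z)
        = (resolventDensity α r (x - z) - resolventDensity α q (x - z)) / (q - r) := by
    have hinner (y : ℝ) : ⟪𝓕 (modulatedSymbol α q x) y, 𝓕 (modulatedSymbol α r z) y⟫ =
        ((resolventDensity α q (x - y) * resolventDensity α r (y - z) : ℝ) : ℂ) := by
      rw [fourier_modulatedSymbol hα1 hq, fourier_modulatedSymbol hα1 hr, RCLike.inner_apply,
        Complex.conj_ofReal, ← neg_sub y x, resolventDensity_neg, mul_comm, Complex.ofReal_mul]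
    have hzero {p : ℝ} (hp : 0 < p) :
        ∫ v, modulatedSymbol α p (z - x) v = (resolventDensity α p (x - z) : ℂ) := by
      rw [← neg_sub z x, ← zero_sub, ← fourier_modulatedSymbol hα1 hp,
        fourier_real_eq_integral_exp_smul]
      simp
    have hint := integrable_inner_fourier
      (integrable_modulatedSymbol hα1 hq x) (memLp_two_modulatedSymbol hα1 hq x)
      (integrable_modulatedSymbol hα1 hr z) (memLp_two_modulatedSymbol hα1 hr z)
    have heq := integral_inner_fourier
      (integrable_modulatedSymbol hα1 hq x) (memLp_two_modulatedSymbol hα1 hq x)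
      (integrable_modulatedSymbol hα1 hr z) (memLp_two_modulatedSymbol hα1 hr z)
    simp only [hinner, inner_modulatedSymbol hq hr hqr] at hint heq
    refine ⟨by simpa using hint.re, ?_⟩
    rw [integral_complex_ofReal, integral_div, integral_sub (integrable_modulatedSymbol hα1 hr _)
      (integrable_modulatedSymbol hα1 hq _), hzero hr, hzero hq] at heq
    exact_mod_cast heq
  refine ⟨key, ?_⟩
  simpa [resolventDensity_neg] using (key 0 0).2
end

section
/- For every q > 0 the function u_q is Lebesgue integrable on ℝ and ∫_ℝ u_q(x) dx = 1/q. -/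
open MeasureTheory Set Filter Real

lemma integrableOn_Ioi_rpow_div_add_rpow_pow {α q s : ℝ} {k : ℕ} (hq : 0 < q) (hs : -1 < s)
    (hk : s - α * k < -1) :
    IntegrableOn (fun l : ℝ => l ^ s / (q + l ^ α) ^ k) (Ioi 0) := by
  have hm : Measurable (fun l : ℝ => l ^ s / (q + l ^ α) ^ k) := by fun_prop
  rw [← Ioc_union_Ioi_eq_Ioi zero_le_one]
  refine IntegrableOn.union ?_ ?_
  · have h : IntegrableOn (fun l : ℝ => l ^ s / q ^ k) (Ioc 0 1) :=
      ((intervalIntegrable_iff_integrableOn_Ioc_of_le zero_le_one).1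
        (intervalIntegral.intervalIntegrable_rpow' hs)).div_const _
    refine h.mono' hm.aestronglyMeasurable ?_
    filter_upwards [ae_restrict_mem measurableSet_Ioc] with l hl
    have hl0 : 0 < l := hl.1
    rw [Real.norm_of_nonneg (by positivity)]
    gcongr
    linarith [rpow_nonneg hl0.le α]
  · refine (integrableOn_Ioi_rpow_of_lt hk one_pos).mono' hm.aestronglyMeasurable ?_
    filter_upwards [ae_restrict_mem measurableSet_Ioi] with l hl
    have hl0 : 0 < l := one_pos.trans hl
    rw [Real.norm_of_nonneg (by positivity), rpow_sub hl0, rpow_mul_natCast hl0.le]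
    gcongr
    linarith

lemma integrable_comp_abs_of_integrableOn_Ioi {f : ℝ → ℝ} (hf : IntegrableOn f (Ioi 0)) :
    Integrable (fun x => f |x|) := by
  have h : IntegrableOn (fun x => f |x|) (Ioi 0) :=
    hf.congr_fun (fun x hx => by simp [abs_of_pos (mem_Ioi.1 hx)]) measurableSet_Ioi
  rw [← integrableOn_univ, ← Iic_union_Ioi (a := (0 : ℝ))]
  refine IntegrableOn.union ?_ h
  rw [← integrableOn_Ici_iff_integrableOn_Ioi] at h
  have h2 : IntegrableOn (fun x => f |-x|) (Iic 0) := by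
    refine IntegrableOn.comp_neg_Iic (f := fun x => f |x|) ?_
    simpa using h
  simpa using h2

/-- The negative of the second derivative of `l ↦ 1 / (q + l ^ α)` is integrable since `α > 1`. -/
lemma integrableOn_deriv2_one_div_add_rpow {α q : ℝ} (hα : 1 < α) (hq : 0 < q) :
    IntegrableOn (fun l : ℝ => α * (α - 1) * (l ^ (α - 2) / (q + l ^ α) ^ 2)
      - 2 * α ^ 2 * (l ^ (2 * α - 2) / (q + l ^ α) ^ 3)) (Ioi 0) :=
  ((integrableOn_Ioi_rpow_div_add_rpow_pow hq (by linarith) (by norm_num; linarith)).const_mul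
    _).sub ((integrableOn_Ioi_rpow_div_add_rpow_pow hq (by linarith)
      (by norm_num; linarith)).const_mul _)

lemma integrableOn_one_div_add_rpow {α q : ℝ} (hα : 1 < α) (hq : 0 < q) :
    IntegrableOn (fun l : ℝ => 1 / (q + l ^ α)) (Ioi 0) := by
  simpa using integrableOn_Ioi_rpow_div_add_rpow_pow (α := α) (s := 0) (k := 1) hq
    (by norm_num) (by simpa using hα)

lemma integrableOn_cos_mul {f : ℝ → ℝ} {s : Set ℝ} (hf : IntegrableOn f s) (x : ℝ) :
    IntegrableOn (fun l => cos (x * l) * f l) s :=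
  hf.bdd_mul (c := 1) (by fun_prop) (by filter_upwards with l using abs_cos_le_one _)

lemma hasDerivAt_one_div_add_rpow {α q l : ℝ} (hq : 0 < q) (hl : 0 < l) :
    HasDerivAt (fun l : ℝ => 1 / (q + l ^ α)) (-(α * l ^ (α - 1) / (q + l ^ α) ^ 2)) l := by
  have hD : q + l ^ α ≠ 0 := by positivity
  have h := ((hasDerivAt_rpow_const (p := α) (Or.inl hl.ne')).const_add q).fun_inv hD
  simpa only [one_div, neg_div] using h

lemma hasDerivAt_deriv_one_div_add_rpow {α q l : ℝ} (hq : 0 < q) (hl : 0 < l) :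
    HasDerivAt (fun l : ℝ => α * l ^ (α - 1) / (q + l ^ α) ^ 2)
      (α * (α - 1) * (l ^ (α - 2) / (q + l ^ α) ^ 2)
        - 2 * α ^ 2 * (l ^ (2 * α - 2) / (q + l ^ α) ^ 3)) l := by
  have hD : q + l ^ α ≠ 0 := by positivity
  have h := ((hasDerivAt_rpow_const (p := α - 1) (Or.inl hl.ne')).const_mul α).fun_div
    (((hasDerivAt_rpow_const (p := α) (Or.inl hl.ne')).const_add q).fun_pow 2)
    (pow_ne_zero 2 hD)
  refine h.congr_deriv ?_
  rw [show α - 1 - 1 = α - 2 by ring, show 2 * α - 2 = (α - 1) + (α - 1) by ring, rpow_add hl]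
  field_simp
  ring

lemma tendsto_one_div_add_rpow_atTop {α : ℝ} (hα : 0 < α) (q : ℝ) :
    Tendsto (fun l : ℝ => 1 / (q + l ^ α)) atTop (nhds 0) :=
  (tendsto_atTop_add_const_left _ q (tendsto_rpow_atTop hα)).const_div_atTop 1

lemma tendsto_deriv_one_div_add_rpow_atTop {α q : ℝ} (hα : 0 < α) (hq : 0 < q) :
    Tendsto (fun l : ℝ => α * l ^ (α - 1) / (q + l ^ α) ^ 2) atTop (nhds 0) := by
  have h0 : Tendsto (fun l : ℝ => α * l ^ (-(α + 1))) atTop (nhds 0) := by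
    simpa using (tendsto_rpow_neg_atTop (by linarith : 0 < α + 1)).const_mul α
  refine squeeze_zero' ?_ ?_ h0
  · filter_upwards [eventually_gt_atTop 0] with l hl
    positivity
  · filter_upwards [eventually_gt_atTop 0] with l hl
    rw [show -(α + 1) = (α - 1) - α * (2 : ℕ) by push_cast; ring, rpow_sub hl (α - 1),
      rpow_mul_natCast hl.le, ← mul_div_assoc]
    gcongr
    linarith

/-- Two integrations by parts: the boundary terms vanish since `α > 1`. -/
lemma integral_cos_div_add_rpow {α q x : ℝ} (hα : 1 < α) (hq : 0 < q) (hx : x ≠ 0) :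
    ∫ l in Ioi (0 : ℝ), cos (x * l) / (q + l ^ α) =
      (∫ l in Ioi (0 : ℝ), cos (x * l) * (α * (α - 1) * (l ^ (α - 2) / (q + l ^ α) ^ 2)
        - 2 * α ^ 2 * (l ^ (2 * α - 2) / (q + l ^ α) ^ 3))) / x ^ 2 := by
  have hg := integrableOn_cos_mul (integrableOn_one_div_add_rpow hα hq) x
  have hh := (integrableOn_cos_mul (integrableOn_deriv2_one_div_add_rpow hα hq) x).div_const (x ^ 2)
  have key := integral_Ioi_of_hasDerivAt_of_tendsto (a := 0) (m := 0)
    (f := fun l : ℝ => sin (x * l) / x * (1 / (q + l ^ α))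
      - cos (x * l) / x ^ 2 * (α * l ^ (α - 1) / (q + l ^ α) ^ 2)) ?_ (fun l hl => ?_)
    (hg.sub hh) ?_
  · simp only [Pi.sub_apply] at key
    rw [integral_sub hg hh, integral_div] at key
    simp only [mul_one_div, mul_zero, sin_zero, zero_div,
      zero_rpow (by linarith : α - 1 ≠ 0), sub_zero] at key
    linarith
  · have hD : q + (0 : ℝ) ^ α ≠ 0 := by positivity
    have c1 : ContinuousAt (fun l : ℝ => l ^ α) 0 :=
      continuousAt_rpow_const _ _ (Or.inr (by linarith))
    have c2 : ContinuousAt (fun l : ℝ => l ^ (α - 1)) 0 :=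
      continuousAt_rpow_const _ _ (Or.inr (by linarith))
    have c3 := continuousAt_const (y := q) |>.add c1
    have c4 := (continuousAt_const (y := (1 : ℝ))).div c3 hD
    have c5 := (continuousAt_const (y := α) |>.mul c2).div (c3.pow 2) (pow_ne_zero 2 hD)
    have c6 : ContinuousAt (fun l : ℝ => sin (x * l) / x) 0 := by fun_prop
    have c7 : ContinuousAt (fun l : ℝ => cos (x * l) / x ^ 2) 0 := by fun_prop
    exact ((c6.mul c4).sub (c7.mul c5)).continuousWithinAt
  · have hs : HasDerivAt (fun l : ℝ => sin (x * l) / x) (cos (x * l)) l := by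
      refine ((((hasDerivAt_id l).const_mul x).sin).div_const x).congr_deriv ?_
      simp only [id, mul_one]
      field_simp
    have hc : HasDerivAt (fun l : ℝ => cos (x * l) / x ^ 2) (-(sin (x * l) / x)) l := by
      refine ((((hasDerivAt_id l).const_mul x).cos).div_const (x ^ 2)).congr_deriv ?_
      simp only [id, mul_one]
      field_simp
    refine ((hs.mul (hasDerivAt_one_div_add_rpow hq hl)).sub
      (hc.mul (hasDerivAt_deriv_one_div_add_rpow hq hl))).congr_deriv ?_
    simp only [Pi.sub_apply]
    ring
  · have t1 : Tendsto (fun l : ℝ => sin (x * l) / x * (1 / (q + l ^ α))) atTop (nhds 0) := by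
      refine isBoundedUnder_le_mul_tendsto_zero (isBoundedUnder_of ⟨1 / |x|, fun l => ?_⟩)
        (tendsto_one_div_add_rpow_atTop (by linarith) q)
      simp only [Function.comp_apply, norm_eq_abs, abs_div]
      gcongr
      exact abs_sin_le_one _
    have t2 : Tendsto (fun l : ℝ => cos (x * l) / x ^ 2 * (α * l ^ (α - 1) / (q + l ^ α) ^ 2))
        atTop (nhds 0) := by
      refine isBoundedUnder_le_mul_tendsto_zero (isBoundedUnder_of ⟨1 / |x ^ 2|, fun l => ?_⟩)
        (tendsto_deriv_one_div_add_rpow_atTop (by linarith) hq)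
      simp only [Function.comp_apply, norm_eq_abs, abs_div]
      gcongr
      exact abs_cos_le_one _
    simpa using t1.sub t2

lemma continuous_resolventDensity {α q : ℝ} (hα : 1 < α) (hq : 0 < q) :
    Continuous (resolventDensity α q) := by
  refine continuous_const.mul (continuous_of_dominated
    (bound := fun l => ‖1 / (q + l ^ α)‖) (fun x => ?_) (fun x => ?_)
    (integrableOn_one_div_add_rpow hα hq).norm ?_)
  · exact (by fun_prop : Measurable fun l : ℝ => cos (x * l) / (q + l ^ α)).aestronglyMeasurable
  · filter_upwards with l
    rw [← mul_one_div, norm_mul]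
    exact mul_le_of_le_one_left (norm_nonneg _) (abs_cos_le_one _)
  · filter_upwards with l
    fun_prop

lemma abs_integral_cos_mul_le {f : ℝ → ℝ} {s : Set ℝ} (hf : IntegrableOn f s) (x : ℝ) :
    |∫ l in s, cos (x * l) * f l| ≤ ∫ l in s, |f l| := by
  refine norm_integral_le_of_norm_le (f := fun l => cos (x * l) * f l) hf.abs ?_
  filter_upwards with l
  rw [norm_mul]
  exact mul_le_of_le_one_left (norm_nonneg _) (abs_cos_le_one _)

lemma integrable_resolventDensity {α q : ℝ} (hα : 1 < α) (hq : 0 < q) :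
    Integrable (resolventDensity α q) := by
  obtain ⟨A, hA⟩ : ∃ A, ∀ x, |∫ l in Ioi (0 : ℝ), cos (x * l) / (q + l ^ α)| ≤ A :=
    ⟨_, fun x => by
      simpa only [mul_one_div] using
        abs_integral_cos_mul_le (integrableOn_one_div_add_rpow hα hq) x⟩
  obtain ⟨B, hB⟩ : ∃ B, ∀ x, x ^ 2 * |∫ l in Ioi (0 : ℝ), cos (x * l) / (q + l ^ α)| ≤ B := by
    refine ⟨∫ l in Ioi (0 : ℝ), |α * (α - 1) * (l ^ (α - 2) / (q + l ^ α) ^ 2)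
        - 2 * α ^ 2 * (l ^ (2 * α - 2) / (q + l ^ α) ^ 3)|, fun x => ?_⟩
    rcases eq_or_ne x 0 with rfl | hx
    · rw [zero_pow two_ne_zero, zero_mul]
      exact integral_nonneg fun l => abs_nonneg _
    · rw [integral_cos_div_add_rpow hα hq hx, abs_div, abs_of_nonneg (sq_nonneg x),
        mul_div_cancel₀ _ (pow_ne_zero 2 hx)]
      exact abs_integral_cos_mul_le (integrableOn_deriv2_one_div_add_rpow hα hq) x
  refine (integrable_inv_one_add_sq.const_mul (1 / π * (A + B))).mono'
    (continuous_resolventDensity hα hq).aestronglyMeasurable ?_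
  filter_upwards with x
  rw [resolventDensity, norm_mul, Real.norm_of_nonneg (by positivity), mul_assoc, norm_eq_abs]
  gcongr
  rw [← div_eq_mul_inv, le_div_iff₀ (by positivity)]
  linarith [hA x, hB x]

open FourierTransform in
lemma fourier_comp_abs (f : ℝ → ℝ) (hf : IntegrableOn f (Ioi 0)) (w : ℝ) :
    𝓕 (fun v : ℝ => (f |v| : ℂ)) w =
      ((2 * ∫ l in Ioi (0 : ℝ), cos (2 * π * w * l) * f l : ℝ) : ℂ) := by
  have hi := integrable_comp_abs_of_integrableOn_Ioi hf
  have hc : Integrable (fun v : ℝ => cos (2 * π * w * v) * f |v|) :=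
    hi.bdd_mul (c := 1) (by fun_prop) (by filter_upwards with l using abs_cos_le_one _)
  have hs : Integrable (fun v : ℝ => sin (2 * π * w * v) * f |v|) :=
    hi.bdd_mul (c := 1) (by fun_prop) (by filter_upwards with l using abs_sin_le_one _)
  have hs0 : ∫ v : ℝ, sin (2 * π * w * v) * f |v| = 0 := by
    have := integral_neg_eq_self (fun v : ℝ => sin (2 * π * w * v) * f |v|) volume
    simp only [mul_neg, sin_neg, abs_neg, neg_mul, integral_neg] at this
    linarith
  have hc0 : ∫ v : ℝ, cos (2 * π * w * v) * f |v| =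
      2 * ∫ l in Ioi (0 : ℝ), cos (2 * π * w * l) * f l := by
    rw [← integral_comp_abs (f := fun l => cos (2 * π * w * l) * f l)]
    congr 1 with v
    rcases abs_choice v with h | h <;> simp [h]
  rw [Real.fourier_real_eq_integral_exp_smul, ← hc0, ← integral_complex_ofReal]
  have : ∀ v : ℝ, Complex.exp (↑(-2 * π * v * w) * Complex.I) • (f |v| : ℂ) =
      ((cos (2 * π * w * v) * f |v| : ℝ) : ℂ)
        - ((sin (2 * π * w * v) * f |v| : ℝ) : ℂ) * Complex.I := by
    intro v
    rw [Complex.exp_mul_I, ← Complex.ofReal_cos, ← Complex.ofReal_sin,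
      show -2 * π * v * w = -(2 * π * w * v) by ring, cos_neg, sin_neg]
    push_cast [smul_eq_mul]
    ring
  simp_rw [this]
  rw [integral_sub hc.ofReal (hs.ofReal.mul_const _), integral_mul_const,
    integral_complex_ofReal (f := fun v : ℝ => sin (2 * π * w * v) * f |v|), hs0]
  simp

/-- For every `q > 0` the resolvent density `u_q` is Lebesgue integrable on `ℝ`
and `∫_ℝ u_q(x) dx = 1/q`. -/
theorem resolventDensity_integral (α : ℝ) (hα1 : 1 < α) (hα2 : α ≤ 2)
    (q : ℝ) (hq : 0 < q) :
    Integrable (resolventDensity α q) ∧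
    ∫ x : ℝ, resolventDensity α q x = 1 / q := by
  have hint := integrable_resolventDensity hα1 hq
  refine ⟨hint, ?_⟩
  have hg := integrableOn_one_div_add_rpow hα1 hq
  have hF : FourierTransform.fourier (fun v : ℝ => ((1 / (q + |v| ^ α) : ℝ) : ℂ)) =
      fun w => ((2 * π * resolventDensity α q (2 * π * w) : ℝ) : ℂ) := by
    ext w
    rw [fourier_comp_abs (fun l => 1 / (q + l ^ α)) hg w, resolventDensity]
    congr 1
    simp only [mul_one_div]
    field_simp
  have hπ : (2 * π) ≠ 0 := by positivity
  have hcont : Continuous (fun v : ℝ => ((1 / (q + |v| ^ α) : ℝ) : ℂ)) := by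
    refine Complex.continuous_ofReal.comp (continuous_const.div
      (continuous_const.add (continuous_abs.rpow_const fun _ => Or.inr (by linarith))) fun v => ?_)
    positivity
  have hinv := congrFun (hcont.fourierInv_fourier_eq
    (integrable_comp_abs_of_integrableOn_Ioi hg).ofReal (by
      rw [hF]
      exact (((integrable_comp_mul_left_iff _ hπ).2 hint).const_mul (2 * π)).ofReal)) 0
  rw [hF, Real.fourierInv_eq'] at hinv
  simp only [inner_zero_right, mul_zero, Complex.ofReal_zero, zero_mul, Complex.exp_zero, one_smul,
    integral_complex_ofReal, Complex.ofReal_inj, abs_zero, zero_rpow (by linarith : α ≠ 0),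
    add_zero] at hinv
  rw [← hinv, integral_const_mul, Measure.integral_comp_mul_left (resolventDensity α q),
    abs_of_pos (by positivity), smul_eq_mul, mul_inv_cancel_left₀ hπ]
end

section
/- (Tauberian convergence lemma.) Suppose ψ_t(u) = ψ₁(u) ψ₂(t − u) for 0 < u < t, where ψ₁ is a nonnegative Lebesgue-integrable function on (0,∞) and ψ₂ is a nonnegative bounded measurable function on (0,∞) with lim_{u→∞} ψ₂(u) = ψ₂(∞) > 0. Suppose in addition that the function t ↦ ∫_0^t (t − u)^{γ−1} ψ₁(u) ψ₂(t − u) du is non-increasing on [T, ∞) for some T > 0. Then I(ψ_t, t) = ∫_0^t [ (1 − u/t)^{γ−1} − 1 ] ψ₁(u) ψ₂(t − u) du → 0 as t → ∞. -/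
open MeasureTheory Set Filter Real

/-- The weighted kernel `v ↦ v ^ (γ - 1) * ψ v`, cut off outside `(0, t)`. -/
noncomputable def truncatedKernel (γ : ℝ) (ψ : ℝ → ℝ) (t : ℝ) : ℝ → ℝ :=
  (Ioo 0 t).indicator fun v => v ^ (γ - 1) * ψ v

section truncatedKernel

variable {γ : ℝ} {ψ : ℝ → ℝ} {M t : ℝ}

theorem measurable_truncatedKernel (hψ : Measurable ψ) : Measurable (truncatedKernel γ ψ t) :=
  ((measurable_id.pow_const _).mul hψ).indicator measurableSet_Ioo

theorem truncatedKernel_nonneg (hψ : ∀ u, 0 < u → 0 ≤ ψ u) (v : ℝ) :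
    0 ≤ truncatedKernel γ ψ t v :=
  indicator_nonneg (fun v hv => mul_nonneg (rpow_nonneg hv.1.le _) (hψ v hv.1)) v

theorem integrableOn_Ioo_rpow_mul_const (hγ : 0 < γ) (ht : 0 ≤ t) :
    IntegrableOn (fun v : ℝ => v ^ (γ - 1) * M) (Ioo 0 t) := by
  have h : IntervalIntegrable (fun v : ℝ => v ^ (γ - 1)) volume 0 t :=
    intervalIntegral.intervalIntegrable_rpow' (by linarith)
  rw [intervalIntegrable_iff_integrableOn_Ioo_of_le ht] at h
  exact h.mul_const M

theorem integrable_truncatedKernel (hγ : 0 < γ) (ht : 0 ≤ t) (hψ : ∀ u, 0 < u → 0 ≤ ψ u)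
    (hm : Measurable ψ) (hM : ∀ u, 0 < u → ψ u ≤ M) : Integrable (truncatedKernel γ ψ t) := by
  refine ((integrableOn_Ioo_rpow_mul_const (M := M) hγ ht).integrable_indicator
    measurableSet_Ioo).mono (measurable_truncatedKernel hm).aestronglyMeasurable
    (.of_forall fun v => ?_)
  rw [truncatedKernel, norm_indicator_eq_indicator_norm, norm_indicator_eq_indicator_norm]
  refine indicator_le_indicator' fun hv => ?_
  have h₀ := rpow_nonneg hv.1.le (γ - 1)
  rw [norm_of_nonneg (mul_nonneg h₀ (hψ v hv.1)),
    norm_of_nonneg (mul_nonneg h₀ ((hψ v hv.1).trans (hM v hv.1)))]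
  exact mul_le_mul_of_nonneg_left (hM v hv.1) h₀

theorem integral_truncatedKernel_le (hγ : 0 < γ) (ht : 0 ≤ t) (hψ : ∀ u, 0 < u → 0 ≤ ψ u)
    (hm : Measurable ψ) (hM : ∀ u, 0 < u → ψ u ≤ M) :
    ∫ v, truncatedKernel γ ψ t v ≤ t ^ γ / γ * M := by
  have hint := integrable_truncatedKernel hγ ht hψ hm hM
  rw [truncatedKernel, integrable_indicator_iff measurableSet_Ioo] at hint
  rw [truncatedKernel, integral_indicator measurableSet_Ioo]
  calc ∫ v in Ioo 0 t, v ^ (γ - 1) * ψ v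
      ≤ ∫ v in Ioo 0 t, v ^ (γ - 1) * M :=
        setIntegral_mono_on hint (integrableOn_Ioo_rpow_mul_const hγ ht) measurableSet_Ioo
          fun v hv => mul_le_mul_of_nonneg_left (hM v hv.1) (rpow_nonneg hv.1.le _)
    _ = t ^ γ / γ * M := by
        rw [integral_mul_const, ← integral_Ioc_eq_integral_Ioo,
          ← intervalIntegral.integral_of_le ht, integral_rpow (.inl (by linarith))]
        simp [zero_rpow hγ.ne']

theorem intervalIntegral_truncatedKernel_sub_le {a b : ℝ} (hab : a ≤ b) (hγ : 0 < γ) (ht : 0 ≤ t)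
    (hψ : ∀ u, 0 < u → 0 ≤ ψ u) (hm : Measurable ψ) (hM : ∀ u, 0 < u → ψ u ≤ M) (u : ℝ) :
    ∫ s in a..b, truncatedKernel γ ψ t (s - u) ≤ t ^ γ / γ * M := by
  rw [intervalIntegral.integral_of_le hab]
  refine (setIntegral_le_integral ((integrable_truncatedKernel hγ ht hψ hm hM).comp_sub_right u)
    (.of_forall fun s => truncatedKernel_nonneg hψ _)).trans ?_
  rw [integral_sub_right_eq_self (truncatedKernel γ ψ t)]
  exact integral_truncatedKernel_le hγ ht hψ hm hM

theorem setIntegral_eq_integral_truncatedKernel (φ : ℝ → ℝ) {s : ℝ} (hs : s ≤ t) :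
    ∫ u in Ioo 0 s, (s - u) ^ (γ - 1) * (φ u * ψ (s - u)) =
      ∫ u, (Ioi 0).indicator φ u * truncatedKernel γ ψ t (s - u) := by
  rw [← integral_indicator measurableSet_Ioo]
  congr 1 with u
  by_cases hu : u ∈ Ioo 0 s
  · have h₁ : s - u ∈ Ioo 0 t := ⟨by linarith [hu.2], by linarith [hu.1]⟩
    rw [indicator_of_mem hu, indicator_of_mem (mem_Ioi.2 hu.1), truncatedKernel,
      indicator_of_mem h₁]
    ring
  · rw [indicator_of_notMem hu]
    by_cases h₀ : 0 < u
    · have h₁ : s - u ∉ Ioo 0 t := fun h => hu ⟨h₀, by linarith [h.1]⟩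
      rw [truncatedKernel, indicator_of_notMem h₁, mul_zero]
    · rw [indicator_of_notMem (by simpa using h₀), zero_mul]

end truncatedKernel

theorem integrable_prod_mul_comp_sub {p k : ℝ → ℝ} (hp : Integrable p) (hk : Integrable k)
    (s : Set ℝ) :
    Integrable (fun z : ℝ × ℝ => p z.2 * k (z.1 - z.2)) ((volume.restrict s).prod volume) := by
  have h := hp.convolution_integrand (ContinuousLinearMap.mul ℝ ℝ) hk
  refine h.mono_measure ?_
  exact Measure.prod_mono Measure.restrict_le_self le_rfl

theorem intervalIntegral_integral_mul_comp_sub {p k : ℝ → ℝ} (hp : Integrable p)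
    (hk : Integrable k) {a b : ℝ} (hab : a ≤ b) :
    ∫ s in a..b, ∫ u, p u * k (s - u) = ∫ u, p u * ∫ s in a..b, k (s - u) := by
  simp only [intervalIntegral.integral_of_le hab]
  rw [integral_integral_swap (integrable_prod_mul_comp_sub hp hk _)]
  simp only [integral_const_mul]

theorem integrable_mul_intervalIntegral_comp_sub {p k : ℝ → ℝ} (hp : Integrable p)
    (hk : Integrable k) {a b : ℝ} (hab : a ≤ b) :
    Integrable fun u => p u * ∫ s in a..b, k (s - u) := by
  simpa only [intervalIntegral.integral_of_le hab, integral_const_mul] using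
    (integrable_prod_mul_comp_sub hp hk (Ioc a b)).integral_prod_right

theorem AntitoneOn.sub_mul_le_intervalIntegral {f : ℝ → ℝ} {a b : ℝ} (hab : a ≤ b)
    (hf : AntitoneOn f (Icc a b)) : (b - a) * f b ≤ ∫ s in a..b, f s := by
  have hi : IntervalIntegrable f volume a b :=
    AntitoneOn.intervalIntegrable (by rwa [uIcc_of_le hab])
  have h := intervalIntegral.integral_mono_on hab
    (intervalIntegrable_const (c := f b)) hi
    fun x hx => hf hx (right_mem_Icc.2 hab) hx.2
  simpa using h

/-- The averages of the rescaled kernel over `[t * (1 - δ), t]` converge as `t → ∞`. -/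
theorem tendsto_average_truncatedKernel {γ M c δ u : ℝ} {ψ : ℝ → ℝ} (hγ : γ < 1)
    (hψ : ∀ u, 0 < u → 0 ≤ ψ u) (hm : Measurable ψ) (hM : ∀ u, 0 < u → ψ u ≤ M)
    (hlim : Tendsto ψ atTop (nhds c)) (hδ : 0 < δ) (hδ' : δ ≤ 1 / 4) (hu : 0 < u) :
    Tendsto (fun t : ℝ => t ^ (-γ) * ∫ s in t * (1 - δ)..t, truncatedKernel γ ψ t (s - u))
      atTop (nhds (∫ x in (1 - δ)..1, x ^ (γ - 1) * c)) := by
  have hM₀ : 0 ≤ M := (hψ 1 one_pos).trans (hM 1 one_pos)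
  have huIoc : uIoc (1 - δ) 1 = Ioc (1 - δ) 1 := uIoc_of_le (by linarith)
  have hmem : ∀ t x : ℝ, 4 * u ≤ t → x ∈ Ioc (1 - δ) 1 → t * x - u ∈ Ioo 0 t ∧
      t * (1 / 2) ≤ t * x - u := by
    intro t x ht hx
    have h₁ : t * (3 / 4) ≤ t * x := mul_le_mul_of_nonneg_left (by linarith [hx.1]) (by linarith)
    have h₂ : t * x ≤ t * 1 := mul_le_mul_of_nonneg_left hx.2 (by linarith)
    exact ⟨⟨by linarith, by linarith⟩, by linarith⟩
  have hpow : ∀ t y : ℝ, 0 < t → 0 ≤ y →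
      t ^ (1 - γ) * (t * y) ^ (γ - 1) = y ^ (γ - 1) := by
    intro t y ht hy
    rw [mul_rpow ht.le hy, ← mul_assoc, ← rpow_add ht]
    simp
  have key : Tendsto (fun t : ℝ => ∫ x in (1 - δ)..1,
      t ^ (1 - γ) * truncatedKernel γ ψ t (t * x - u))
      atTop (nhds (∫ x in (1 - δ)..1, x ^ (γ - 1) * c)) := by
    refine intervalIntegral.tendsto_integral_filter_of_dominated_convergence
      (fun _ => (1 / 2 : ℝ) ^ (γ - 1) * M) (.of_forall fun t => ?_) ?_
      intervalIntegrable_const (.of_forall fun x hx => ?_)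
    · exact (((measurable_truncatedKernel hm).comp
        ((measurable_const.mul measurable_id).sub_const u)).const_mul _).aestronglyMeasurable
    · filter_upwards [eventually_ge_atTop (4 * u)] with t ht
      refine .of_forall fun x hx => ?_
      have ht₀ : 0 < t := by linarith
      obtain ⟨h₁, h₂⟩ := hmem t x ht (huIoc ▸ hx)
      rw [norm_of_nonneg (mul_nonneg (rpow_nonneg ht₀.le _) (truncatedKernel_nonneg hψ _)),
        truncatedKernel, indicator_of_mem h₁, ← mul_assoc]
      refine mul_le_mul ?_ (hM _ h₁.1) (hψ _ h₁.1) (by positivity)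
      rw [← hpow t (1 / 2) ht₀ (by norm_num)]
      exact mul_le_mul_of_nonneg_left
        (rpow_le_rpow_of_nonpos (by positivity) h₂ (by linarith)) (by positivity)
    · rw [huIoc] at hx
      have hx₀ : 0 < x := by linarith [hx.1]
      have h₁ : Tendsto (fun t : ℝ => (x - u / t) ^ (γ - 1)) atTop (nhds (x ^ (γ - 1))) := by
        refine Tendsto.rpow_const ?_ (.inl hx₀.ne')
        simpa using (tendsto_const_nhds (x := x)).sub
          ((tendsto_const_nhds (x := u)).div_atTop tendsto_id)
      have h₂ : Tendsto (fun t : ℝ => ψ (t * x - u)) atTop (nhds c) :=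
        hlim.comp (tendsto_atTop_add_const_right _ (-u) (tendsto_id.atTop_mul_const hx₀))
      refine (h₁.mul h₂).congr' ?_
      filter_upwards [eventually_ge_atTop (4 * u)] with t ht
      have ht₀ : 0 < t := by linarith
      have h₃ := (hmem t x ht hx).1
      have h₄ : t * x - u = t * (x - u / t) := by field_simp
      have h₅ : 0 ≤ x - u / t := by
        have := h₃.1
        rw [h₄] at this
        exact ((mul_pos_iff_of_pos_left ht₀).1 this).le
      rw [truncatedKernel, indicator_of_mem h₃, ← mul_assoc, ← hpow t _ ht₀ h₅, ← h₄]
  refine key.congr' ?_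
  filter_upwards [eventually_gt_atTop 0] with t ht
  rw [intervalIntegral.integral_const_mul,
    intervalIntegral.integral_comp_mul_left (fun s => truncatedKernel γ ψ t (s - u)) ht.ne',
    mul_one, smul_eq_mul, ← mul_assoc, ← rpow_neg_one t, ← rpow_add ht]
  congr 2
  ring

theorem tendsto_integral_mul_average_truncatedKernel {γ M c δ : ℝ} {p ψ : ℝ → ℝ} (hγ₀ : 0 < γ)
    (hγ : γ < 1) (hp : Integrable p) (hp₀ : ∀ u ≤ 0, p u = 0)
    (hψ : ∀ u, 0 < u → 0 ≤ ψ u) (hm : Measurable ψ) (hM : ∀ u, 0 < u → ψ u ≤ M)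
    (hlim : Tendsto ψ atTop (nhds c)) (hδ : 0 < δ) (hδ' : δ ≤ 1 / 4) :
    Tendsto (fun t : ℝ => t ^ (-γ) *
        ∫ u, p u * ∫ s in t * (1 - δ)..t, truncatedKernel γ ψ t (s - u))
      atTop (nhds ((∫ u, p u) * ∫ x in (1 - δ)..1, x ^ (γ - 1) * c)) := by
  simp only [← integral_const_mul, ← integral_mul_const]
  refine tendsto_integral_filter_of_dominated_convergence (fun u => ‖p u‖ * (M / γ)) ?_ ?_
    (hp.norm.mul_const _) (.of_forall fun u => ?_)
  · filter_upwards [eventually_gt_atTop 0] with t ht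
    exact ((integrable_mul_intervalIntegral_comp_sub hp
      (integrable_truncatedKernel hγ₀ ht.le hψ hm hM)
      (by nlinarith)).const_mul _).aestronglyMeasurable
  · filter_upwards [eventually_gt_atTop 0] with t ht
    refine .of_forall fun u => ?_
    have hab : t * (1 - δ) ≤ t := by nlinarith
    have h₀ : 0 ≤ ∫ s in t * (1 - δ)..t, truncatedKernel γ ψ t (s - u) :=
      intervalIntegral.integral_nonneg hab fun s _ => truncatedKernel_nonneg hψ _
    have h₁ := intervalIntegral_truncatedKernel_sub_le hab hγ₀ ht.le hψ hm hM u
    rw [mul_left_comm, norm_mul, norm_of_nonneg (mul_nonneg (rpow_nonneg ht.le _) h₀)]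
    refine mul_le_mul_of_nonneg_left ?_ (norm_nonneg _)
    calc _ ≤ t ^ (-γ) * (t ^ γ / γ * M) := mul_le_mul_of_nonneg_left h₁ (rpow_nonneg ht.le _)
      _ = (t ^ (-γ) * t ^ γ) * (M / γ) := by ring
      _ = M / γ := by rw [← rpow_add ht]; simp
  · rcases le_or_gt u 0 with hu | hu
    · simp [hp₀ u hu]
    · simp only [mul_left_comm _ (p u)]
      exact (tendsto_average_truncatedKernel hγ hψ hm hM hlim hδ hδ' hu).const_mul _

theorem tendsto_setIntegral_mul_comp_sub {M c : ℝ} {φ ψ : ℝ → ℝ} (hφ : IntegrableOn φ (Ioi 0))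
    (hψ : ∀ u, 0 < u → 0 ≤ ψ u) (hm : Measurable ψ) (hM : ∀ u, 0 < u → ψ u ≤ M)
    (hlim : Tendsto ψ atTop (nhds c)) :
    Tendsto (fun t : ℝ => ∫ u in Ioo 0 t, φ u * ψ (t - u)) atTop
      (nhds ((∫ u in Ioi 0, φ u) * c)) := by
  have hM₀ : 0 ≤ M := (hψ 1 one_pos).trans (hM 1 one_pos)
  have h : ∀ t : ℝ, ∫ u in Ioo 0 t, φ u * ψ (t - u) =
      ∫ u in Ioi 0, φ u * (Ioi 0).indicator ψ (t - u) := by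
    intro t
    rw [← integral_indicator measurableSet_Ioo, ← integral_indicator measurableSet_Ioi]
    congr 1 with u
    by_cases h₀ : 0 < u <;> by_cases h₁ : u < t <;> simp [indicator, h₀, h₁]
  simp only [h, ← integral_mul_const]
  refine tendsto_integral_filter_of_dominated_convergence (fun u => ‖φ u‖ * M)
    (.of_forall fun t => ?_) (.of_forall fun t => .of_forall fun u => ?_)
    (hφ.norm.mul_const _) (.of_forall fun u => ?_)
  · exact hφ.aestronglyMeasurable.mul ((hm.indicator measurableSet_Ioi).comp
      (measurable_const.sub measurable_id)).aestronglyMeasurable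
  · rw [norm_mul]
    refine mul_le_mul_of_nonneg_left ?_ (norm_nonneg _)
    by_cases h₁ : 0 < t - u
    · rw [indicator_of_mem (mem_Ioi.2 h₁), norm_of_nonneg (hψ _ h₁)]
      exact hM _ h₁
    · rwa [indicator_of_notMem (by simpa using h₁), norm_zero]
  · refine Tendsto.const_mul _ ?_
    refine (hlim.comp (tendsto_atTop_add_const_right _ (-u) tendsto_id)).congr' ?_
    filter_upwards [eventually_gt_atTop u] with t ht
    rw [indicator_of_mem (mem_Ioi.2 (sub_pos.2 ht))]
    rfl

theorem integrableOn_mul_comp_sub {M t : ℝ} {φ ψ : ℝ → ℝ} (hφ : IntegrableOn φ (Ioi 0))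
    (hψ : ∀ u, 0 < u → 0 ≤ ψ u) (hm : Measurable ψ) (hM : ∀ u, 0 < u → ψ u ≤ M) :
    IntegrableOn (fun u => φ u * ψ (t - u)) (Ioo 0 t) := by
  refine Integrable.mul_bdd (c := M) (hφ.mono_set Ioo_subset_Ioi_self)
    (hm.comp (measurable_const.sub measurable_id)).aestronglyMeasurable ?_
  refine (ae_restrict_iff' measurableSet_Ioo).2 (.of_forall fun u hu => ?_)
  have h₁ : 0 < t - u := sub_pos.2 hu.2
  rw [norm_of_nonneg (hψ _ h₁)]
  exact hM _ h₁

theorem one_sub_div_rpow {γ t u : ℝ} (ht : 0 < t) (hu : u ≤ t) :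
    (1 - u / t) ^ (γ - 1) = t ^ (1 - γ) * (t - u) ^ (γ - 1) := by
  have h : 1 - u / t = t⁻¹ * (t - u) := by field_simp
  rw [h, mul_rpow (by positivity) (by linarith), inv_rpow ht.le, ← rpow_neg ht.le, neg_sub]

/-- The bound holds without assuming that the left-hand integral converges: if it does not, the
left-hand side is `0` by convention. -/
theorem setIntegral_sub_one_mul_le {γ t : ℝ} {g : ℝ → ℝ} (ht : 0 < t)
    (hg : IntegrableOn g (Ioo 0 t)) :
    ∫ u in Ioo 0 t, ((1 - u / t) ^ (γ - 1) - 1) * g u ≤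
      max 0 (t ^ (1 - γ) * (∫ u in Ioo 0 t, (t - u) ^ (γ - 1) * g u) - ∫ u in Ioo 0 t, g u) := by
  by_cases hi : IntegrableOn (fun u => ((1 - u / t) ^ (γ - 1) - 1) * g u) (Ioo 0 t)
  · refine le_max_of_le_right (le_of_eq ?_)
    rw [eq_sub_iff_add_eq, ← integral_add hi hg, ← integral_const_mul]
    refine setIntegral_congr_fun measurableSet_Ioo fun u hu => ?_
    simp only [one_sub_div_rpow ht hu.2.le]
    ring
  · rw [integral_undef hi]
    exact le_max_left _ _

theorem setIntegral_sub_one_mul_nonneg {γ t : ℝ} {g : ℝ → ℝ} (hγ : γ ≤ 1)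
    (hg : ∀ u ∈ Ioo 0 t, 0 ≤ g u) :
    0 ≤ ∫ u in Ioo 0 t, ((1 - u / t) ^ (γ - 1) - 1) * g u := by
  refine setIntegral_nonneg measurableSet_Ioo fun u hu => mul_nonneg ?_ (hg u hu)
  have ht : 0 < t := hu.1.trans hu.2
  have h₁ : u / t < 1 := (div_lt_one ht).2 hu.2
  have h₂ : 0 < u / t := div_pos hu.1 ht
  exact sub_nonneg.2 (one_le_rpow_of_pos_of_le_one_of_nonpos (by linarith) (by linarith)
    (by linarith))

theorem intervalIntegral_rpow_mul_le {γ c δ : ℝ} (hγ : γ ≤ 1) (hc : 0 ≤ c) (hδ : 0 < δ)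
    (hδ' : δ < 1) : ∫ x in (1 - δ)..1, x ^ (γ - 1) * c ≤ δ * ((1 - δ) ^ (γ - 1) * c) := by
  have hle : 1 - δ ≤ 1 := by linarith
  have hi : IntervalIntegrable (fun x : ℝ => x ^ (γ - 1) * c) volume (1 - δ) 1 := by
    refine (intervalIntegral.intervalIntegrable_rpow (.inr ?_)).mul_const c
    rw [uIcc_of_le hle]
    exact fun h => by linarith [h.1]
  have h := intervalIntegral.integral_mono_on hle hi
    (intervalIntegrable_const (c := (1 - δ) ^ (γ - 1) * c)) fun x hx =>
      mul_le_mul_of_nonneg_right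
        (rpow_le_rpow_of_nonpos (by linarith) hx.1 (by linarith)) hc
  simpa [mul_left_comm] using h

/-- Tauberian convergence lemma: with `ψ_t(u) = ψ₁(u) ψ₂(t − u)`, where `ψ₁ ≥ 0`
is integrable on `(0,∞)`, `ψ₂ ≥ 0` is bounded measurable with
`ψ₂(u) → c > 0` as `u → ∞`, and assuming
`t ↦ ∫_0^t (t − u)^{γ−1} ψ₁(u) ψ₂(t − u) du` is non-increasing on `[T, ∞)`
for some `T > 0`, one has
`I(ψ_t, t) = ∫_0^t [ (1 − u/t)^{γ−1} − 1 ] ψ₁(u) ψ₂(t − u) du → 0` as `t → ∞`. -/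
theorem tauberian_convergence_lemma (γ : ℝ) (hγ : γ ∈ Ioo (0 : ℝ) 1)
    (ψ₁ ψ₂ : ℝ → ℝ) (c : ℝ) (hc : 0 < c)
    (hψ₁_nonneg : ∀ u : ℝ, 0 < u → 0 ≤ ψ₁ u)
    (hψ₁_int : IntegrableOn ψ₁ (Ioi 0))
    (hψ₂_nonneg : ∀ u : ℝ, 0 < u → 0 ≤ ψ₂ u)
    (hψ₂_meas : Measurable ψ₂)
    (hψ₂_bdd : ∃ M : ℝ, ∀ u : ℝ, 0 < u → ψ₂ u ≤ M)
    (hψ₂_lim : Tendsto ψ₂ atTop (nhds c))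
    (T : ℝ) (hT : 0 < T)
    (hmono : AntitoneOn
      (fun t : ℝ => ∫ u in Ioo (0 : ℝ) t, (t - u) ^ (γ - 1) * (ψ₁ u * ψ₂ (t - u)))
      (Ici T)) :
    Tendsto
      (fun t : ℝ =>
        ∫ u in Ioo (0 : ℝ) t, ((1 - u / t) ^ (γ - 1) - 1) * (ψ₁ u * ψ₂ (t - u)))
      atTop (nhds 0) := by
  obtain ⟨hγ₀, hγ₁⟩ := hγ
  obtain ⟨M, hM⟩ := hψ₂_bdd
  have hp : Integrable ((Ioi 0).indicator ψ₁) := hψ₁_int.integrable_indicator measurableSet_Ioi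
  have hp₀ : ∀ u ≤ 0, (Ioi 0).indicator ψ₁ u = 0 := fun u hu =>
    indicator_of_notMem (by simpa using hu) _
  have hA : 0 ≤ ∫ u in Ioi 0, ψ₁ u := setIntegral_nonneg measurableSet_Ioi hψ₁_nonneg
  refine tendsto_order.2 ⟨fun e he => .of_forall fun t => he.trans_le ?_, fun e he => ?_⟩
  · exact setIntegral_sub_one_mul_nonneg hγ₁.le fun u hu =>
      mul_nonneg (hψ₁_nonneg u hu.1) (hψ₂_nonneg _ (sub_pos.2 hu.2))
  set A := ∫ u in Ioi 0, ψ₁ u with hA_def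
  obtain ⟨δ, hδ, hδ', hδe⟩ : ∃ δ : ℝ, 0 < δ ∧ δ ≤ 1 / 4 ∧
      A * ((1 - δ) ^ (γ - 1) * c) - A * c < e := by
    have h : Tendsto (fun δ : ℝ => A * ((1 - δ) ^ (γ - 1) * c) - A * c)
        (nhdsWithin 0 (Ioi 0)) (nhds 0) := by
      have h₁ : ContinuousAt (fun δ : ℝ => A * ((1 - δ) ^ (γ - 1) * c) - A * c) 0 := by
        have : ContinuousAt (fun δ : ℝ => (1 - δ) ^ (γ - 1)) 0 :=
          (continuousAt_const.sub continuousAt_id).rpow_const (.inl (by simp))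
        fun_prop
      simpa [ContinuousAt] using h₁.tendsto.mono_left nhdsWithin_le_nhds
    obtain ⟨δ, h₁, h₂, h₃⟩ := ((h.eventually_lt_const he).and
      (Ioc_mem_nhdsGT (show (0 : ℝ) < 1 / 4 by norm_num))).exists
    exact ⟨δ, h₂, h₃, h₁⟩
  have hupper := ((tendsto_integral_mul_average_truncatedKernel hγ₀ hγ₁ hp hp₀ hψ₂_nonneg
    hψ₂_meas hM hψ₂_lim hδ hδ').const_mul δ⁻¹).sub
    (tendsto_setIntegral_mul_comp_sub hψ₁_int hψ₂_nonneg hψ₂_meas hM hψ₂_lim)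
  rw [integral_indicator measurableSet_Ioi, ← hA_def] at hupper
  have hlt : δ⁻¹ * (A * ∫ x in (1 - δ)..1, x ^ (γ - 1) * c) - A * c < e := by
    refine lt_of_le_of_lt (sub_le_sub_right ?_ _) hδe
    rw [inv_mul_le_iff₀ hδ, mul_left_comm]
    exact mul_le_mul_of_nonneg_left
      (intervalIntegral_rpow_mul_le hγ₁.le hc.le hδ (by linarith)) hA
  filter_upwards [hupper.eventually_lt_const hlt, eventually_ge_atTop (2 * T)] with t hte ht
  have ht₀ : 0 < t := by linarith
  have hab : t * (1 - δ) ≤ t := by nlinarith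
  have hTa : T ≤ t * (1 - δ) := by nlinarith
  refine (setIntegral_sub_one_mul_le ht₀
    (integrableOn_mul_comp_sub hψ₁_int hψ₂_nonneg hψ₂_meas hM)).trans_lt (max_lt he ?_)
  refine lt_of_le_of_lt (sub_le_sub_right ?_ _) hte
  have havg := AntitoneOn.sub_mul_le_intervalIntegral hab
    (hmono.mono fun s hs => hTa.trans hs.1)
  have hfubini : ∫ s in t * (1 - δ)..t,
      (∫ u in Ioo 0 s, (s - u) ^ (γ - 1) * (ψ₁ u * ψ₂ (s - u))) =
      ∫ u, (Ioi 0).indicator ψ₁ u * ∫ s in t * (1 - δ)..t, truncatedKernel γ ψ₂ t (s - u) := by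
    rw [← intervalIntegral_integral_mul_comp_sub hp
      (integrable_truncatedKernel hγ₀ ht₀.le hψ₂_nonneg hψ₂_meas hM) hab]
    refine intervalIntegral.integral_congr fun s hs => ?_
    rw [uIcc_of_le hab] at hs
    exact setIntegral_eq_integral_truncatedKernel ψ₁ hs.2
  rw [← hfubini]
  have hscale : t ^ (1 - γ) = δ⁻¹ * t ^ (-γ) * (t - t * (1 - δ)) := by
    rw [sub_eq_add_neg, rpow_add ht₀, rpow_one]
    field_simp
    ring
  rw [hscale, mul_assoc, ← mul_assoc δ⁻¹]
  exact mul_le_mul_of_nonneg_left havg (by positivity)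
end
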